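/- With G = (X, Y) as defined below, assume additionally sin θ ≠ 0 and q > 2p. Then the signature of G at 0 is (p, q − p): the least integer n ≥ 1 with G⁽ⁿ⁾(0) ≠ 0 is n = p (with G⁽ᵖ⁾(0) = p!·(1, 0)), and the least integer m > p such that G⁽ᵖ⁾(0) and G⁽ᵐ⁾(0) are linearly independent over ℝ is m = q − p (with G^{(q−p)}(0) = (q−p)!·(−ε·d·qβ cos θ/p, −ε·d·qβ sin θ/p)). In particular, if p ≥ 2, the singular place (h^p, β·h^q) generates singular offset places. -/

import Mathlib

/-- The speed `s(h) = √(p² + q²β²·h^{2(q−p)})` of the place `(h^p, β·h^q)` divided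
by `h^{p−1}`; it is everywhere positive. -/
noncomputable def offSpeed (p q : ℕ) (β : ℝ) (h : ℝ) : ℝ :=
  Real.sqrt ((p : ℝ) ^ 2 + (q : ℝ) ^ 2 * β ^ 2 * h ^ (2 * (q - p)))

/-- First coordinate of the generalized offset place of `(h^p, β·h^q)` at distance
`d` and angle `θ`, with sign `ε`. -/
noncomputable def offX (p q : ℕ) (β d θ ε : ℝ) (h : ℝ) : ℝ :=
  h ^ p + ε * d * (-((q : ℝ) * β * Real.cos θ) * h ^ (q - p) - (p : ℝ) * Real.sin θ)
    / offSpeed p q β h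

/-- Second coordinate of the generalized offset place of `(h^p, β·h^q)` at distance
`d` and angle `θ`, with sign `ε`. -/
noncomputable def offY (p q : ℕ) (β d θ ε : ℝ) (h : ℝ) : ℝ :=
  β * h ^ q + ε * d * (-((q : ℝ) * β * Real.sin θ) * h ^ (q - p) + (p : ℝ) * Real.cos θ)
    / offSpeed p q β h

/-- The generalized offset place `G = (X, Y)` of the place `(h^p, β·h^q)`. -/
noncomputable def offG (p q : ℕ) (β d θ ε : ℝ) (h : ℝ) : ℝ × ℝ :=
  (offX p q β d θ ε h, offY p q β d θ ε h)

open scoped ContDiff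

/-- The derivatives at `0` of order less than `m` of `h ↦ h ^ m • w h` vanish for smooth `w`. -/
theorem iteratedDeriv_pow_smul_zero_of_lt {E : Type*} [NormedAddCommGroup E] [NormedSpace ℝ E]
    {n m : ℕ} (hnm : n < m) {w : ℝ → E} (hw : ContDiff ℝ ∞ w) :
    iteratedDeriv n (fun h : ℝ => h ^ m • w h) 0 = 0 := by
  induction n generalizing m w with
  | zero => simp [(Nat.ne_of_gt hnm)]
  | succ n ih =>
    obtain ⟨m, rfl⟩ : ∃ k, m = k + 1 := ⟨m - 1, by omega⟩
    have hw' : ContDiff ℝ ∞ (deriv w) := (contDiff_infty_iff_deriv.mp hw).2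
    have hderiv : deriv (fun h : ℝ => h ^ (m + 1) • w h)
        = fun h : ℝ => h ^ m • (((m : ℝ) + 1) • w h + h • deriv w h) := by
      funext h
      have hd : HasDerivAt w (deriv w h) h :=
        (hw.differentiable (by simp)).differentiableAt.hasDerivAt
      rw [((hasDerivAt_pow (m + 1) h).fun_smul hd).deriv]
      simp only [Nat.add_sub_cancel, Nat.cast_add, Nat.cast_one]
      module
    rw [iteratedDeriv_succ', hderiv]
    exact ih (by omega) ((contDiff_const.smul hw).add (contDiff_id.smul hw'))

theorem iteratedDeriv_pow_smul_const_zero {E : Type*} [NormedAddCommGroup E] [NormedSpace ℝ E]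
    (n m : ℕ) (v : E) :
    iteratedDeriv n (fun h : ℝ => h ^ m • v) 0 = if n = m then (m.factorial : ℝ) • v else 0 := by
  rw [iteratedDeriv_smul_const (by fun_prop), iteratedDeriv_fun_pow_zero]
  split_ifs <;> simp

/-- Derivatives at `0`, up to order `k`, of a smooth curve expanded to order `k`. -/
theorem iteratedDeriv_two_term_expansion {E : Type*} [NormedAddCommGroup E] [NormedSpace ℝ E]
    {n p k : ℕ} (hn : 1 ≤ n) (hnk : n ≤ k) (c v₁ v₂ : E) {w : ℝ → E} (hw : ContDiff ℝ ∞ w) :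
    iteratedDeriv n (fun h : ℝ => c + (h ^ p • v₁ + h ^ k • v₂ + h ^ (k + 1) • w h)) 0
      = (if n = p then (p.factorial : ℝ) • v₁ else 0)
        + (if n = k then (k.factorial : ℝ) • v₂ else 0) := by
  have hwn : ContDiff ℝ n w := hw.of_le (by exact_mod_cast le_top)
  rw [iteratedDeriv_const_add (by omega), iteratedDeriv_fun_add (by fun_prop) (by fun_prop),
    iteratedDeriv_fun_add (by fun_prop) (by fun_prop), iteratedDeriv_pow_smul_const_zero,
    iteratedDeriv_pow_smul_const_zero, iteratedDeriv_pow_smul_zero_of_lt (by omega) hw, add_zero]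

theorem offSpeed_radicand_pos {p : ℕ} (hp : 1 ≤ p) (q : ℕ) (β h : ℝ) :
    0 < (p : ℝ) ^ 2 + (q : ℝ) ^ 2 * β ^ 2 * h ^ (2 * (q - p)) := by
  have : (0 : ℝ) < p := by exact_mod_cast hp
  rw [pow_mul' h 2 (q - p)]
  positivity

theorem offSpeed_pos {p : ℕ} (hp : 1 ≤ p) (q : ℕ) (β h : ℝ) : 0 < offSpeed p q β h :=
  Real.sqrt_pos.mpr (offSpeed_radicand_pos hp q β h)

theorem contDiff_offSpeed {p : ℕ} (hp : 1 ≤ p) (q : ℕ) (β : ℝ) :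
    ContDiff ℝ ∞ (offSpeed p q β) :=
  ContDiff.sqrt (by fun_prop) fun h => (offSpeed_radicand_pos hp q β h).ne'

/-- The inverse speed is `1 / p` up to a smooth multiple of `h ^ (2 * (q - p))`. -/
theorem exists_contDiff_inv_offSpeed {p : ℕ} (hp : 1 ≤ p) (q : ℕ) (β : ℝ) :
    ∃ u : ℝ → ℝ, ContDiff ℝ ∞ u ∧
      ∀ h, (offSpeed p q β h)⁻¹ = (p : ℝ)⁻¹ + h ^ (2 * (q - p)) * u h := by
  have hp0 : (0 : ℝ) < p := by exact_mod_cast hp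
  have hs := contDiff_offSpeed hp q β
  refine ⟨fun h => -((q : ℝ) ^ 2 * β ^ 2)
    / (p * offSpeed p q β h * (p + offSpeed p q β h)), ?_, fun h => ?_⟩
  · refine ContDiff.div (by fun_prop) (by fun_prop) fun h => ?_
    have := offSpeed_pos hp q β h
    positivity
  · have hpos := offSpeed_pos hp q β h
    have hsq : offSpeed p q β h ^ 2
        = (p : ℝ) ^ 2 + (q : ℝ) ^ 2 * β ^ 2 * h ^ (2 * (q - p)) :=
      Real.sq_sqrt (offSpeed_radicand_pos hp q β h).le
    have hsum : (p : ℝ) + offSpeed p q β h ≠ 0 := by positivity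
    field_simp
    linear_combination -hsq

theorem exists_offG_expansion {p q : ℕ} (hp : 1 ≤ p) (hq : p < q) (β d θ ε : ℝ) :
    ∃ (c : ℝ × ℝ) (w : ℝ → ℝ × ℝ), ContDiff ℝ ∞ w ∧
      offG p q β d θ ε = fun h => c + (h ^ p • ((1 : ℝ), (0 : ℝ))
        + h ^ (q - p) • (-(ε * d * (q : ℝ) * β * Real.cos θ / (p : ℝ)),
           -(ε * d * (q : ℝ) * β * Real.sin θ / (p : ℝ)))
        + h ^ (q - p + 1) • w h) := by
  obtain ⟨u, hu, hinv⟩ := exists_contDiff_inv_offSpeed hp q β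
  have hp0 : (p : ℝ) ≠ 0 := by exact_mod_cast (by omega : p ≠ 0)
  refine ⟨(-(ε * d * Real.sin θ), ε * d * Real.cos θ), fun h =>
    (h ^ (q - p - 1) * (ε * d * (-((q : ℝ) * β * Real.cos θ) * h ^ (q - p)
        - (p : ℝ) * Real.sin θ)) * u h,
      β * h ^ (p - 1) + h ^ (q - p - 1) * (ε * d * (-((q : ℝ) * β * Real.sin θ) * h ^ (q - p)
        + (p : ℝ) * Real.cos θ)) * u h), by fun_prop, ?_⟩
  obtain ⟨a, rfl⟩ : ∃ a, p = a + 1 := ⟨p - 1, by omega⟩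
  obtain ⟨b, rfl⟩ : ∃ b, q = a + 1 + (b + 1) := ⟨q - (a + 1) - 1, by omega⟩
  funext h
  simp only [Nat.add_sub_cancel_left, Nat.add_sub_cancel] at hinv ⊢
  ext
  · simp only [offG, offX, Nat.add_sub_cancel_left, div_eq_mul_inv, hinv, Prod.fst_add, Prod.smul_fst,
      smul_eq_mul]
    field_simp
    ring
  · simp only [offG, offY, Nat.add_sub_cancel_left, div_eq_mul_inv, hinv, Prod.snd_add, Prod.smul_snd,
      smul_eq_mul]
    field_simp
    ring

/-- for `sin θ ≠ 0` and `q > 2p`, the signature of `G` at `0` is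
`(p, q − p)`: the iterated derivatives of order `< p` vanish, `G⁽ᵖ⁾(0) = p!·(1,0) ≠ 0`,
for `p < m < q − p` the pair `(G⁽ᵖ⁾(0), G⁽ᵐ⁾(0))` is linearly dependent, and
`G^{(q−p)}(0) = (q−p)!·(−εdqβ cos θ/p, −εdqβ sin θ/p)` is linearly independent
from `G⁽ᵖ⁾(0)`. -/
theorem offG_signature_q_gt_two_p (p q : ℕ) (hp : 1 ≤ p) (hq : 2 * p < q)
    (β d θ ε : ℝ) (hβ : β ≠ 0) (hd : d ≠ 0) (hθ : Real.sin θ ≠ 0)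
    (hε : ε = 1 ∨ ε = -1) :
    (∀ n : ℕ, 1 ≤ n → n < p → iteratedDeriv n (offG p q β d θ ε) 0 = 0) ∧
    iteratedDeriv p (offG p q β d θ ε) 0 = (p.factorial : ℝ) • ((1 : ℝ), (0 : ℝ)) ∧
    iteratedDeriv p (offG p q β d θ ε) 0 ≠ 0 ∧
    (∀ m : ℕ, p < m → m < q - p →
      ¬ LinearIndependent ℝ
        ![iteratedDeriv p (offG p q β d θ ε) 0, iteratedDeriv m (offG p q β d θ ε) 0]) ∧
    iteratedDeriv (q - p) (offG p q β d θ ε) 0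
      = ((q - p).factorial : ℝ) •
          (-(ε * d * (q : ℝ) * β * Real.cos θ / (p : ℝ)),
           -(ε * d * (q : ℝ) * β * Real.sin θ / (p : ℝ))) ∧
    LinearIndependent ℝ
      ![iteratedDeriv p (offG p q β d θ ε) 0, iteratedDeriv (q - p) (offG p q β d θ ε) 0] := by
  obtain ⟨c, w, hw, hG⟩ := exists_offG_expansion hp (by omega : p < q) β d θ ε
  have key : ∀ n, 1 ≤ n → n ≤ q - p → iteratedDeriv n (offG p q β d θ ε) 0
      = (if n = p then (p.factorial : ℝ) • ((1 : ℝ), (0 : ℝ)) else 0)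
        + (if n = q - p then ((q - p).factorial : ℝ) •
          (-(ε * d * (q : ℝ) * β * Real.cos θ / (p : ℝ)),
           -(ε * d * (q : ℝ) * β * Real.sin θ / (p : ℝ))) else 0) :=
    fun n h1 h2 => hG ▸ iteratedDeriv_two_term_expansion h1 h2 c _ _ hw
  have hp0 : (p : ℝ) ≠ 0 := by exact_mod_cast (by omega : p ≠ 0)
  have hq0 : (q : ℝ) ≠ 0 := by exact_mod_cast (by omega : q ≠ 0)
  have hε0 : ε ≠ 0 := by rcases hε with rfl | rfl <;> norm_num
  have hDp : iteratedDeriv p (offG p q β d θ ε) 0 = (p.factorial : ℝ) • ((1 : ℝ), (0 : ℝ)) := by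
    rw [key p hp (by omega), if_pos rfl, if_neg (by omega), add_zero]
  have hDk := key (q - p) (by omega) le_rfl
  rw [if_neg (by omega), if_pos rfl, zero_add] at hDk
  refine ⟨fun n h1 h2 => ?_, hDp, ?_, fun m h1 h2 hli => ?_, hDk, ?_⟩
  · rw [key n h1 (by omega), if_neg (by omega), if_neg (by omega), add_zero]
  · rw [hDp]
    simp [Nat.factorial_ne_zero]
  · refine hli.ne_zero 1 ?_
    simp only [Matrix.cons_val_one, Matrix.cons_val_fin_one]
    rw [key m (by omega) h2.le, if_neg (by omega), if_neg (by omega), add_zero]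
  · rw [hDp, hDk, LinearIndependent.pair_iff]
    intro s t hst
    simp only [Prod.smul_mk, Prod.mk_add_mk, smul_eq_mul, Prod.mk_eq_zero, mul_one, mul_zero,
      zero_add] at hst
    obtain ⟨hX, hY⟩ := hst
    have ht : t = 0 := by
      simpa [Nat.factorial_ne_zero, hp0, hq0, hε0, hd, hβ, hθ] using hY
    subst ht
    simpa [Nat.factorial_ne_zero] using hX
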